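/- Let d ≥ 1 be an integer and let η : [0,1]^d → [0,1] be a function. Define f_η(x) = 1 if η(x) ≥ 1/2 and f_η(x) = −1 otherwise. Suppose λ_d(∂{x : η(x) = 1/2}) = 0 and that η is λ_d-almost everywhere continuous, i.e. there exists an open subset U of [0,1]^d with λ_d(U) = 1 such that the restriction of η to U is continuous. Then there exists g ∈ F^(d) such that g(x) = f_η(x) for λ_d-almost every x ∈ [0,1]^d. -/

import Mathlib

open MeasureTheory Set
open scoped ENNReal

noncomputable section

/-- Points of `ℝ^d`. -/
abbrev Pt (d : ℕ) : Type := Fin d → ℝ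

/-- The unit cube `[0,1]^d`. -/
def unitCube (d : ℕ) : Set (Pt d) := Set.Icc 0 1

/-- Lebesgue measure `λ_d` on `[0,1]^d`. -/
def lamd (d : ℕ) : Measure (Pt d) := volume.restrict (unitCube d)

/-- The dyadic subinterval of `[0,1]` at level `j` with index `k`:
`[k 2^{-j}, (k+1) 2^{-j})` for `k < 2^j - 1` and `[1 - 2^{-j}, 1]` for `k = 2^j - 1`. -/
def dyadicI (j k : ℕ) : Set ℝ :=
  if k = 2 ^ j - 1 then Set.Icc (1 - ((2 : ℝ) ^ j)⁻¹) 1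
  else Set.Ico ((k : ℝ) / 2 ^ j) (((k : ℝ) + 1) / 2 ^ j)

/-- The dyadic cube `I_k^{(j)} ⊆ [0,1]^d` at level `j` with multi-index `k`. -/
def dyadicCube (d j : ℕ) (k : Fin d → ℕ) : Set (Pt d) :=
  {x | ∀ i, x i ∈ dyadicI j (k i)}

/-- `f` is represented by the (automatically countable) family `T` of pairwise disjoint
dyadic cubes whose union has full Lebesgue measure in `[0,1]^d`, with `f` constant
on each cube of the family. -/
def IsDyadicRep (d : ℕ) (f : Pt d → ℝ) (T : Set (ℕ × (Fin d → ℕ))) : Prop :=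
  (∀ p ∈ T, ∀ i, p.2 i < 2 ^ p.1) ∧
  (T.PairwiseDisjoint fun p => dyadicCube d p.1 p.2) ∧
  lamd d (unitCube d \ ⋃ p ∈ T, dyadicCube d p.1 p.2) = 0 ∧
  (∀ p ∈ T, ∀ x ∈ dyadicCube d p.1 p.2, ∀ y ∈ dyadicCube d p.1 p.2, f x = f y)

/-- The class `F^(d)` of measurable `{-1,1}`-valued functions admitting a dyadic
representation. -/
def memF (d : ℕ) (f : Pt d → ℝ) : Prop :=
  Measurable f ∧ (∀ x, f x = 1 ∨ f x = -1) ∧ ∃ T, IsDyadicRep d f T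

/-- The class `F_w^(d)`: a dyadic representation with at most `w j` cubes of side
`2^{-j}` for every level `j`. -/
def memFw (d : ℕ) (w : ℕ → ℝ) (f : Pt d → ℝ) : Prop :=
  Measurable f ∧ (∀ x, f x = 1 ∨ f x = -1) ∧
    ∃ T, IsDyadicRep d f T ∧
      ∀ j, ((T ∩ {p | p.1 = j}).encard : ℝ≥0∞) ≤ ENNReal.ofReal (w j)

/-- Marginal `P^X` of `π` on `[0,1]^d`. -/
def margX {d : ℕ} (π : Measure (Pt d × ℝ)) : Measure (Pt d) := π.map Prod.fst

/-- The labels of `π` lie in `{-1, 1}` almost surely. -/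
def Labels {d : ℕ} (π : Measure (Pt d × ℝ)) : Prop := π {p | p.2 = 1 ∨ p.2 = -1} = 1

/-- `η` is the regression function (conditional probability of `Y = 1`) of `π`. -/
def IsRegression {d : ℕ} (π : Measure (Pt d × ℝ)) (η : Pt d → ℝ) : Prop :=
  Measurable η ∧ (∀ x, η x ∈ Set.Icc (0 : ℝ) 1) ∧
    ∀ s : Set (Pt d), MeasurableSet s →
      π (s ×ˢ {(1 : ℝ)}) = ∫⁻ x in s, ENNReal.ofReal (η x) ∂(margX π)

/-- The Bayes rule `f*` associated with the regression function `η`. -/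
def bayes {d : ℕ} (η : Pt d → ℝ) (x : Pt d) : ℝ := if 1 / 2 ≤ η x then 1 else -1

/-- Misclassification risk `R(f) = π({(x,y) : f(x) ≠ y})`. -/
def risk {d : ℕ} (π : Measure (Pt d × ℝ)) (f : Pt d → ℝ) : ℝ :=
  (π {p | f p.1 ≠ p.2}).toReal

/-- Assumption (A1): `P^X` is absolutely continuous w.r.t. `λ_d` with density
between `a` and `A`. -/
def A1cond {d : ℕ} (π : Measure (Pt d × ℝ)) (a A : ℝ) : Prop :=
  ∀ s : Set (Pt d), MeasurableSet s →
    ENNReal.ofReal a * lamd d s ≤ margX π s ∧ margX π s ≤ ENNReal.ofReal A * lamd d s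

/-- Strong margin assumption (SMA) with margin `h`. -/
def SMAcond {d : ℕ} (π : Measure (Pt d × ℝ)) (η : Pt d → ℝ) (h : ℝ) : Prop :=
  margX π {x | h ≤ |2 * η x - 1|} = 1

/-- Number of indices `i` satisfying `P i`. -/
def cnt (n : ℕ) (P : Fin n → Prop) : ℕ := Nat.card {i // P i}

/-- Index of the level-`J` dyadic interval containing `t ∈ [0,1]`. -/
def dyadicIdx (J : ℕ) (t : ℝ) : ℕ := min ⌊t * 2 ^ J⌋₊ (2 ^ J - 1)

/-- The level-`J` dyadic cube containing `x ∈ [0,1]^d`. -/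
def cubeOf (d J : ℕ) (x : Pt d) : Set (Pt d) := dyadicCube d J fun i => dyadicIdx J (x i)

open Classical in
/-- The dyadic majority-vote classifier `f̂_n^{(J)}` built from the sample `s`. -/
def fhat (d J n : ℕ) (s : Fin n → Pt d × ℝ) (x : Pt d) : ℝ :=
  if (∃ i, (s i).1 ∈ cubeOf d J x) ∧
      cnt n (fun i => (s i).1 ∈ cubeOf d J x ∧ (s i).2 = -1) <
        cnt n (fun i => (s i).1 ∈ cubeOf d J x ∧ (s i).2 = 1)
  then 1 else -1

/-- The `n`-fold product measure `π^{⊗n}` governing the i.i.d. sample. -/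
def sampM {d : ℕ} (π : Measure (Pt d × ℝ)) [SigmaFinite π] (n : ℕ) :
    Measure (Fin n → Pt d × ℝ) := Measure.pi fun _ => π

/-- Expected excess risk `E_{π^{⊗n}}[R(f̂_n) - R(f*)]` of the classifier `F`. -/
def excessExp {d : ℕ} (π : Measure (Pt d × ℝ)) [SigmaFinite π] (η : Pt d → ℝ) (n : ℕ)
    (F : (Fin n → Pt d × ℝ) → Pt d → ℝ) : ℝ :=
  ∫ s, risk π (F s) ∂(sampM π n) - risk π (bayes η)

/-- The class `P_{w,h,a,A}` of probability measures (together with their regression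
functions) satisfying (A1), (SMA), and whose Bayes rule belongs to `F_w^(d)`. -/
def Pclass (d : ℕ) (w : ℕ → ℝ) (h a A : ℝ) :
    Set (ProbabilityMeasure (Pt d × ℝ) × (Pt d → ℝ)) :=
  {p | Labels (p.1 : Measure (Pt d × ℝ)) ∧ IsRegression (p.1 : Measure (Pt d × ℝ)) p.2 ∧
       A1cond (p.1 : Measure (Pt d × ℝ)) a A ∧ SMAcond (p.1 : Measure (Pt d × ℝ)) p.2 h ∧
       memFw d w (bayes p.2)}

end

open Filter Topology

lemma mem_Icc_of_mem_dyadicI {j k : ℕ} {t : ℝ} (ht : t ∈ dyadicI j k) (hk : k < 2 ^ j) :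
    t ∈ Icc (0 : ℝ) 1 := by
  have h2 : (0 : ℝ) < 2 ^ j := by positivity
  unfold dyadicI at ht
  split_ifs at ht with h
  · refine ⟨le_trans ?_ ht.1, ht.2⟩
    have : ((2 : ℝ) ^ j)⁻¹ ≤ 1 := inv_le_one_of_one_le₀ (one_le_pow₀ (by norm_num))
    linarith
  · refine ⟨le_trans (by positivity) ht.1, ht.2.le.trans ?_⟩
    rw [div_le_one h2]
    exact_mod_cast hk

lemma dyadicIdx_lt (j : ℕ) (t : ℝ) : dyadicIdx j t < 2 ^ j := by
  have : 0 < 2 ^ j := by positivity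
  unfold dyadicIdx
  omega

lemma dyadicIdx_eq_of_mem {j k : ℕ} {t : ℝ} (ht : t ∈ dyadicI j k) (hk : k < 2 ^ j) :
    dyadicIdx j t = k := by
  have h2 : (0 : ℝ) < 2 ^ j := by positivity
  have h0 := (mem_Icc_of_mem_dyadicI ht hk).1
  unfold dyadicI at ht
  unfold dyadicIdx
  split_ifs at ht with h
  · rw [h]
    refine min_eq_right (Nat.le_floor ?_)
    rw [Nat.cast_sub Nat.one_le_two_pow]
    have := mul_le_mul_of_nonneg_right ht.1 h2.le
    rw [sub_mul, inv_mul_cancel₀ h2.ne'] at this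
    push_cast
    linarith
  · have : ⌊t * 2 ^ j⌋₊ = k := by
      rw [Nat.floor_eq_iff (by positivity)]
      exact ⟨(div_le_iff₀ h2).1 ht.1, (lt_div_iff₀ h2).1 ht.2⟩
    omega

lemma mem_dyadicI_dyadicIdx (j : ℕ) {t : ℝ} (ht : t ∈ Icc (0 : ℝ) 1) :
    t ∈ dyadicI j (dyadicIdx j t) := by
  have h2 : (0 : ℝ) < 2 ^ j := by positivity
  have h0 : 0 ≤ t * 2 ^ j := mul_nonneg ht.1 h2.le
  unfold dyadicI
  split_ifs with h
  · refine ⟨?_, ht.2⟩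
    have hle : 2 ^ j - 1 ≤ ⌊t * 2 ^ j⌋₊ := h ▸ min_le_left _ _
    have := (Nat.le_floor_iff h0).1 hle
    rw [Nat.cast_sub Nat.one_le_two_pow] at this
    push_cast at this
    rw [← mul_le_mul_iff_of_pos_right h2, sub_mul, inv_mul_cancel₀ h2.ne']
    linarith
  · have hf : dyadicIdx j t = ⌊t * 2 ^ j⌋₊ := by
      unfold dyadicIdx at h ⊢
      omega
    rw [hf]
    exact ⟨(div_le_iff₀ h2).2 (Nat.floor_le h0), (lt_div_iff₀ h2).2 (Nat.lt_floor_add_one _)⟩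

lemma dyadicIdx_eq_div {i j : ℕ} (hij : i ≤ j) (t : ℝ) :
    dyadicIdx i t = dyadicIdx j t / 2 ^ (j - i) := by
  obtain ⟨m, rfl⟩ := Nat.exists_eq_add_of_le hij
  have hmono : Monotone fun n : ℕ => n / 2 ^ m := fun a b h => Nat.div_le_div_right h
  have hfloor : ⌊t * 2 ^ (i + m)⌋₊ / 2 ^ m = ⌊t * 2 ^ i⌋₊ := by
    have := Nat.floor_div_natCast (t * 2 ^ (i + m)) (2 ^ m)
    rw [← this]
    congr 1
    push_cast
    rw [pow_add]
    field_simp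
  have hlast : (2 ^ (i + m) - 1) / 2 ^ m = 2 ^ i - 1 := by
    have hi : 0 < 2 ^ i := by positivity
    have hm : 0 < 2 ^ m := by positivity
    rw [pow_add, Nat.div_eq_iff hm]
    have : 2 ^ m ≤ 2 ^ i * 2 ^ m := Nat.le_mul_of_pos_left _ hi
    rw [Nat.sub_mul]
    omega
  have := hmono.map_min (a := ⌊t * 2 ^ (i + m)⌋₊) (b := 2 ^ (i + m) - 1)
  simp only [hfloor, hlast] at this
  simp only [dyadicIdx, Nat.add_sub_cancel_left]
  exact this.symm

lemma abs_sub_le_of_mem_dyadicI {j k : ℕ} {s t : ℝ} (hs : s ∈ dyadicI j k)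
    (ht : t ∈ dyadicI j k) : |s - t| ≤ (1 / 2) ^ j := by
  rw [one_div, inv_pow]
  unfold dyadicI at hs ht
  split_ifs at hs ht
  · rw [abs_le]
    constructor <;> linarith [hs.1, hs.2, ht.1, ht.2]
  · rw [add_div, one_div] at hs ht
    rw [abs_le]
    constructor <;> linarith [hs.1, hs.2, ht.1, ht.2]

lemma measurableSet_dyadicI (j k : ℕ) : MeasurableSet (dyadicI j k) := by
  unfold dyadicI
  split_ifs
  exacts [measurableSet_Icc, measurableSet_Ico]

lemma measurableSet_dyadicCube (d j : ℕ) (k : Fin d → ℕ) :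
    MeasurableSet (dyadicCube d j k) := by
  have : dyadicCube d j k = Set.univ.pi fun i => dyadicI j (k i) := by
    ext x
    simp [dyadicCube]
  rw [this]
  exact MeasurableSet.univ_pi fun i => measurableSet_dyadicI j (k i)

lemma mem_unitCube_iff {d : ℕ} {x : Pt d} : x ∈ unitCube d ↔ ∀ i, x i ∈ Icc (0 : ℝ) 1 := by
  simp [unitCube, Pi.le_def, forall_and]

lemma mem_cubeOf_self {d : ℕ} (j : ℕ) {x : Pt d} (hx : x ∈ unitCube d) : x ∈ cubeOf d j x :=
  fun i => mem_dyadicI_dyadicIdx j (mem_unitCube_iff.1 hx i)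

lemma idx_eq_of_mem_dyadicCube {d j : ℕ} {k : Fin d → ℕ} {x : Pt d}
    (hx : x ∈ dyadicCube d j k) (hk : ∀ i, k i < 2 ^ j) :
    (fun i => dyadicIdx j (x i)) = k :=
  funext fun i => dyadicIdx_eq_of_mem (hx i) (hk i)

lemma cubeOf_eq_of_mem {d i j : ℕ} (hij : i ≤ j) {k : Fin d → ℕ} {x y : Pt d}
    (hx : x ∈ dyadicCube d j k) (hy : y ∈ dyadicCube d j k) (hk : ∀ i, k i < 2 ^ j) :
    cubeOf d i x = cubeOf d i y := by
  have h := (idx_eq_of_mem_dyadicCube hx hk).trans (idx_eq_of_mem_dyadicCube hy hk).symm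
  unfold cubeOf
  congr 1
  funext l
  rw [dyadicIdx_eq_div hij, dyadicIdx_eq_div hij]
  exact congrArg (· / 2 ^ (j - i)) (congrFun h l)

lemma exists_cubeOf_subset {d : ℕ} {x : Pt d} (hx : x ∈ unitCube d) {s : Set (Pt d)}
    (hs : s ∈ 𝓝 x) : ∃ j, cubeOf d j x ⊆ s := by
  obtain ⟨ε, hε, hball⟩ := Metric.mem_nhds_iff.1 hs
  obtain ⟨j, hj⟩ := exists_pow_lt_of_lt_one hε (by norm_num : (1 / 2 : ℝ) < 1)
  refine ⟨j, fun y hy => hball ?_⟩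
  rw [Metric.mem_ball]
  refine lt_of_le_of_lt ((dist_pi_le_iff (by positivity)).2 fun i => ?_) hj
  exact abs_sub_le_of_mem_dyadicI (hy i) (mem_cubeOf_self j hx i)

/-- The maximal dyadic cubes on which `f` is constant. -/
def maximalCubes {d : ℕ} (f : Pt d → ℝ) : Set (ℕ × (Fin d → ℕ)) :=
  {p | (∀ i, p.2 i < 2 ^ p.1) ∧
    (∀ x ∈ dyadicCube d p.1 p.2, ∀ y ∈ dyadicCube d p.1 p.2, f x = f y) ∧
    ∀ x ∈ dyadicCube d p.1 p.2, ∀ j < p.1,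
      ¬ ∀ y ∈ cubeOf d j x, ∀ z ∈ cubeOf d j x, f y = f z}

lemma eq_of_mem_maximalCubes {d : ℕ} {f : Pt d → ℝ} {p q : ℕ × (Fin d → ℕ)}
    (hp : p ∈ maximalCubes f) (hq : q ∈ maximalCubes f) {x : Pt d}
    (hxp : x ∈ dyadicCube d p.1 p.2) (hxq : x ∈ dyadicCube d q.1 q.2) : p = q := by
  have hkp := idx_eq_of_mem_dyadicCube hxp hp.1
  have hkq := idx_eq_of_mem_dyadicCube hxq hq.1
  have hlevel : p.1 = q.1 := by
    rcases lt_trichotomy p.1 q.1 with h | h | h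
    · refine absurd ?_ (hq.2.2 x hxq _ h)
      unfold cubeOf
      rw [hkp]
      exact hp.2.1
    · exact h
    · refine absurd ?_ (hp.2.2 x hxp _ h)
      unfold cubeOf
      rw [hkq]
      exact hq.2.1
  refine Prod.ext hlevel ?_
  rw [← hkp, ← hkq, hlevel]

lemma exists_mem_maximalCubes {d : ℕ} {f : Pt d → ℝ} {x : Pt d} (hx : x ∈ unitCube d)
    (hf : ∀ᶠ y in 𝓝 x, f y = f x) : ∃ p ∈ maximalCubes f, x ∈ dyadicCube d p.1 p.2 := by
  classical
  have hex : ∃ j, ∀ y ∈ cubeOf d j x, ∀ z ∈ cubeOf d j x, f y = f z := by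
    obtain ⟨j, hj⟩ := exists_cubeOf_subset hx hf
    exact ⟨j, fun y hy z hz => (hj hy).trans (hj hz).symm⟩
  have hxc := mem_cubeOf_self (Nat.find hex) hx
  have hlt : ∀ i, dyadicIdx (Nat.find hex) (x i) < 2 ^ Nat.find hex :=
    fun i => dyadicIdx_lt _ _
  refine ⟨(Nat.find hex, fun i => dyadicIdx (Nat.find hex) (x i)),
    ⟨hlt, Nat.find_spec hex, fun y hy j hj => ?_⟩, hxc⟩
  rw [cubeOf_eq_of_mem (le_of_lt hj) hy hxc hlt]
  exact Nat.find_min hex hj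

/-- A sign-valued function that is locally constant almost everywhere on the unit cube agrees
almost everywhere with a member of the dyadic class. -/
theorem exists_memF_of_ae_locally_const {d : ℕ} {f : Pt d → ℝ} (hf : ∀ x, f x = 1 ∨ f x = -1)
    (hloc : ∀ᵐ x ∂(lamd d), ∀ᶠ y in 𝓝 x, f y = f x) :
    ∃ g, memF d g ∧ ∀ᵐ x ∂(lamd d), g x = f x := by
  classical
  have hcover : ∀ᵐ x ∂(lamd d), ∃ p ∈ maximalCubes f, x ∈ dyadicCube d p.1 p.2 := by
    filter_upwards [hloc, ae_restrict_mem (measurableSet_Icc : MeasurableSet (unitCube d))]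
      with x hx hxc using exists_mem_maximalCubes hxc hx
  set N : Set (ℕ × (Fin d → ℕ)) :=
    {p | p ∈ maximalCubes f ∧ ∀ x ∈ dyadicCube d p.1 p.2, f x = -1}
  set S : Set (Pt d) := ⋃ p ∈ N, dyadicCube d p.1 p.2
  have hS : MeasurableSet S :=
    MeasurableSet.biUnion N.to_countable fun p _ => measurableSet_dyadicCube d p.1 p.2
  have hgf : ∀ p ∈ maximalCubes f, ∀ x ∈ dyadicCube d p.1 p.2,
      (if x ∈ S then (-1 : ℝ) else 1) = f x := by
    intro p hp x hx
    split_ifs with hxS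
    · obtain ⟨q, hq, hxq⟩ := mem_iUnion₂.1 hxS
      exact (hq.2 x hxq).symm
    · refine ((hf x).resolve_right fun h => hxS ?_).symm
      exact mem_iUnion₂.2 ⟨p, ⟨hp, fun y hy => (hp.2.1 y hy x hx).trans h⟩, hx⟩
  refine ⟨fun x => if x ∈ S then -1 else 1,
    ⟨Measurable.ite hS measurable_const measurable_const, fun x => ?_,
      maximalCubes f, fun p hp => hp.1, ?_, ?_, ?_⟩, ?_⟩
  · dsimp only
    split_ifs <;> simp
  · intro p hp q hq hpq
    exact Set.disjoint_left.2 fun x hxp hxq => hpq (eq_of_mem_maximalCubes hp hq hxp hxq)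
  · refine measure_mono_null (fun x hx => ?_) (ae_iff.1 hcover)
    simpa using hx.2
  · intro p hp x hx y hy
    dsimp only
    rw [hgf p hp x hx, hgf p hp y hy]
    exact hp.2.1 x hx y hy
  · filter_upwards [hcover] with x ⟨p, hp, hx⟩ using hgf p hp x hx

lemma lamd_univ (d : ℕ) : lamd d Set.univ = 1 := by
  simp [lamd, unitCube, Real.volume_Icc_pi]

lemma eventually_bayes_eq {d : ℕ} {η : Pt d → ℝ} {x : Pt d} (hc : ContinuousAt η x)
    (hx : x ∈ unitCube d) (hfr : x ∉ frontier {x | x ∈ unitCube d ∧ η x = 1 / 2}) :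
    ∀ᶠ y in 𝓝 x, bayes η y = bayes η x := by
  rcases lt_trichotomy (η x) (1 / 2) with h | h | h
  · filter_upwards [hc.eventually (gt_mem_nhds h)] with y hy
    simp only [bayes, if_neg hy.not_ge, if_neg h.not_ge]
  · have hint : x ∈ interior {x | x ∈ unitCube d ∧ η x = 1 / 2} := by
      by_contra hni
      exact hfr ⟨subset_closure ⟨hx, h⟩, hni⟩
    filter_upwards [mem_interior_iff_mem_nhds.1 hint] with y hy
    simp only [bayes, hy.2, h]
  · filter_upwards [hc.eventually (lt_mem_nhds h)] with y hy
    simp only [bayes, if_pos hy.le, if_pos h.le]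

/-- If `λ_d(∂{η = 1/2}) = 0` and `η` is `λ_d`-a.e. continuous,
then the plug-in rule `f_η` is `λ_d`-a.e. equal to a member of `F^(d)`. -/
theorem ae_continuous_implies_dyadic (d : ℕ) (hd : 1 ≤ d) (η : Pt d → ℝ)
    (hη : ∀ x, η x ∈ Set.Icc (0 : ℝ) 1)
    (hb : lamd d (frontier {x | x ∈ unitCube d ∧ η x = 1 / 2}) = 0)
    (hc : ∃ U : Set (Pt d), IsOpen U ∧ lamd d U = 1 ∧ ContinuousOn η U) :
    ∃ g, memF d g ∧ ∀ᵐ x ∂(lamd d), g x = bayes η x := by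
  obtain ⟨U, hU, hU1, hcU⟩ := hc
  have : IsProbabilityMeasure (lamd d) := ⟨lamd_univ d⟩
  refine exists_memF_of_ae_locally_const (fun x => ?_) ?_
  · unfold bayes
    split_ifs <;> simp
  · have hUae : ∀ᵐ x ∂(lamd d), x ∈ U := (prob_compl_eq_zero_iff hU.measurableSet).2 hU1
    filter_upwards [hUae, measure_eq_zero_iff_ae_notMem.1 hb,
      ae_restrict_mem (measurableSet_Icc : MeasurableSet (unitCube d))] with x hxU hfr hx
    exact eventually_bayes_eq (hcU.continuousAt (hU.mem_nhds hxU)) hx hfr
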